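/- arXiv:1005.2056 — 2 statements merged into one kernel-verified Lean document; each statement's English description precedes it below -/
import Mathlib

section
/- Let α ≥ 1 be an integer. The function λ ↦ ∫_ℂ (|x|^{2λ}/x^α) φ(x) dV(x), a priori defined and holomorphic for Re λ > α/2 and any smooth compactly supported φ : ℂ → ℂ, extends to a meromorphic function of λ on ℂ which is holomorphic in a neighborhood of λ = 0, and its value at λ = 0 equals the principal value lim_{ε→0⁺} ∫_{|x|>ε} φ(x)/x^α dV(x). -/
open MeasureTheory Filter

lemma integral_cos_pow_mul_sin_pow_mul_exp_eq_zero (a b : ℕ) (m : ℤ)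
    (hm : ((a + b : ℕ) : ℤ) < |m|) :
    ∫ θ in -Real.pi..Real.pi,
      (Real.cos θ : ℂ) ^ a * (Real.sin θ : ℂ) ^ b * Complex.exp (m * Complex.I * θ) = 0 := by
  induction a generalizing m with
  | zero =>
    induction b generalizing m with
    | zero =>
      have hm0 : (m : ℂ) ≠ 0 := by
        rintro h
        have : m = 0 := by exact_mod_cast h
        simp [this] at hm
      simp only [pow_zero, one_mul]
      rw [integral_exp_mul_complex (mul_ne_zero hm0 Complex.I_ne_zero)]
      have : Complex.exp (m * Complex.I * (Real.pi : ℝ)) =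
          Complex.exp (m * Complex.I * ((-Real.pi : ℝ) : ℂ)) := by
        rw [Complex.exp_eq_exp_iff_exists_int]
        exact ⟨m, by push_cast; ring⟩
      rw [this, sub_self, zero_div]
    | succ b ih =>
      have key : ∀ θ : ℝ, (Real.cos θ : ℂ) ^ 0 * (Real.sin θ : ℂ) ^ (b + 1) *
          Complex.exp (m * Complex.I * θ) =
          (-Complex.I / 2) * ((Real.cos θ : ℂ) ^ 0 * (Real.sin θ : ℂ) ^ b *
            Complex.exp ((m + 1 : ℤ) * Complex.I * θ)) - (-Complex.I / 2) *
          ((Real.cos θ : ℂ) ^ 0 * (Real.sin θ : ℂ) ^ b *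
            Complex.exp ((m - 1 : ℤ) * Complex.I * θ)) := by
        intro θ
        have h1 : Complex.exp ((m + 1 : ℤ) * Complex.I * θ) =
            Complex.exp (m * Complex.I * θ) * Complex.exp (θ * Complex.I) := by
          rw [← Complex.exp_add]; congr 1; push_cast; ring
        have h2 : Complex.exp ((m - 1 : ℤ) * Complex.I * θ) =
            Complex.exp (m * Complex.I * θ) * Complex.exp (-θ * Complex.I) := by
          rw [← Complex.exp_add]; congr 1; push_cast; ring
        have h3 : (Real.sin θ : ℂ) =
            (Complex.exp (-θ * Complex.I) - Complex.exp (θ * Complex.I)) * Complex.I / 2 := by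
          rw [Complex.ofReal_sin, Complex.sin]
        rw [h1, h2, pow_succ, h3]
        ring
      simp_rw [key]
      rw [intervalIntegral.integral_sub, intervalIntegral.integral_const_mul,
        intervalIntegral.integral_const_mul, ih, ih]
      · simp
      · grind
      · grind
      · exact Continuous.intervalIntegrable (by fun_prop) _ _
      · exact Continuous.intervalIntegrable (by fun_prop) _ _
  | succ a ih =>
    have key : ∀ θ : ℝ, (Real.cos θ : ℂ) ^ (a + 1) * (Real.sin θ : ℂ) ^ b *
        Complex.exp (m * Complex.I * θ) =
        (1 / 2) * ((Real.cos θ : ℂ) ^ a * (Real.sin θ : ℂ) ^ b *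
          Complex.exp ((m + 1 : ℤ) * Complex.I * θ)) + (1 / 2) *
        ((Real.cos θ : ℂ) ^ a * (Real.sin θ : ℂ) ^ b *
          Complex.exp ((m - 1 : ℤ) * Complex.I * θ)) := by
      intro θ
      have h1 : Complex.exp ((m + 1 : ℤ) * Complex.I * θ) =
          Complex.exp (m * Complex.I * θ) * Complex.exp (θ * Complex.I) := by
        rw [← Complex.exp_add]; congr 1; push_cast; ring
      have h2 : Complex.exp ((m - 1 : ℤ) * Complex.I * θ) =
          Complex.exp (m * Complex.I * θ) * Complex.exp (-θ * Complex.I) := by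
        rw [← Complex.exp_add]; congr 1; push_cast; ring
      have h3 : (Real.cos θ : ℂ) =
          (Complex.exp (θ * Complex.I) + Complex.exp (-θ * Complex.I)) / 2 := by
        rw [Complex.ofReal_cos, Complex.cos]
      rw [h1, h2, pow_succ, h3]
      ring
    simp_rw [key]
    rw [intervalIntegral.integral_add, intervalIntegral.integral_const_mul,
      intervalIntegral.integral_const_mul, ih, ih]
    · simp
    · grind
    · grind
    · exact Continuous.intervalIntegrable (by fun_prop) _ _
    · exact Continuous.intervalIntegrable (by fun_prop) _ _

/-- The `α`-th angular Fourier coefficient of `f` on the circle of radius `r`. -/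
noncomputable def angularCoeff (α : ℕ) (f : ℂ → ℂ) (r : ℝ) : ℂ :=
  ∫ θ in -Real.pi..Real.pi,
    f (r * Complex.exp (θ * Complex.I)) * Complex.exp (((-α : ℤ) : ℂ) * Complex.I * θ)

lemma angularCoeff_multilinear_eq_zero {α n : ℕ} (h : n < α)
    (T : ContinuousMultilinearMap ℝ (fun _ : Fin n => ℂ) ℂ) :
    angularCoeff α (fun x => T fun _ => x) 1 = 0 := by
  classical
  have key : ∀ θ : ℝ, T (fun _ => ((1 : ℝ) : ℂ) * Complex.exp (θ * Complex.I)) *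
      Complex.exp (((-α : ℤ) : ℂ) * Complex.I * θ) =
      ∑ s : Finset (Fin n), T (s.piecewise (fun _ => 1) (fun _ => Complex.I)) *
        ((Real.cos θ : ℂ) ^ s.card * (Real.sin θ : ℂ) ^ sᶜ.card *
          Complex.exp (((-α : ℤ) : ℂ) * Complex.I * θ)) := by
    intro θ
    have h1 : (fun _ : Fin n => ((1 : ℝ) : ℂ) * Complex.exp (θ * Complex.I)) =
        (fun _ => Real.cos θ • (1 : ℂ)) + (fun _ => Real.sin θ • Complex.I) := by
      ext i
      simp [Complex.exp_mul_I]
    rw [h1, T.map_add_univ, Finset.sum_mul]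
    refine Finset.sum_congr rfl fun s _ => ?_
    have h2 : s.piecewise (fun _ => Real.cos θ • (1 : ℂ)) (fun _ => Real.sin θ • Complex.I) =
        fun i => (s.piecewise (fun _ => Real.cos θ) (fun _ => Real.sin θ) i) •
          (s.piecewise (fun _ => (1 : ℂ)) (fun _ => Complex.I) i) := by
      ext i
      by_cases hi : i ∈ s <;> simp [hi]
    rw [h2, T.map_smul_univ, Finset.prod_piecewise]
    simp only [Finset.univ_inter, Finset.prod_const, ← Finset.compl_eq_univ_sdiff,
      Complex.real_smul]
    push_cast
    ring
  unfold angularCoeff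
  simp_rw [key]
  rw [intervalIntegral.integral_finsetSum]
  · refine Finset.sum_eq_zero fun s _ => ?_
    rw [intervalIntegral.integral_const_mul, integral_cos_pow_mul_sin_pow_mul_exp_eq_zero, mul_zero]
    rw [Finset.card_add_card_compl]
    simpa using h
  · intro s _
    exact Continuous.intervalIntegrable (by fun_prop) _ _

lemma continuous_angularCoeff (α : ℕ) {f : ℂ → ℂ} (hf : Continuous f) :
    Continuous (angularCoeff α f) := by
  unfold angularCoeff
  apply intervalIntegral.continuous_parametric_intervalIntegral_of_continuous'
  unfold Function.uncurry
  fun_prop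

lemma exists_norm_taylor_remainder_le {f : ℂ → ℂ} (hf : ContDiff ℝ (⊤ : ℕ∞) f)
    (hfc : HasCompactSupport f) (N : ℕ) :
    ∃ C : ℝ, ∀ x, ‖f x - ∑ n ∈ Finset.range N,
      (n.factorial : ℝ)⁻¹ • iteratedFDeriv ℝ n f 0 (fun _ => x)‖ ≤ C * ‖x‖ ^ N := by
  cases N with
  | zero =>
    obtain ⟨C, hC⟩ := hfc.exists_bound_of_continuous hf.continuous
    exact ⟨C, by simpa using hC⟩
  | succ N =>
    obtain ⟨C, hC⟩ := (hfc.iteratedFDeriv (𝕜 := ℝ) (N + 1)).exists_bound_of_continuous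
      (hf.continuous_iteratedFDeriv (by exact_mod_cast le_top))
    refine ⟨(N.factorial : ℝ)⁻¹ * C, fun x => ?_⟩
    have h := map_add_eq_sum_add_integral_iteratedFDeriv (f := f) (x := 0) (y := x) (n := N)
      (fun t _ => (hf.of_le (by exact_mod_cast le_top)).contDiffAt)
    rw [zero_add] at h
    rw [h, add_sub_cancel_left, norm_smul, norm_inv, RCLike.norm_natCast, mul_assoc]
    gcongr
    refine (intervalIntegral.norm_integral_le_of_norm_le_const (C := C * ‖x‖ ^ (N + 1))
      fun t ht => ?_).trans (by simp)
    rw [Set.uIoc_of_le zero_le_one] at ht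
    have h1 : ‖(1 - t) ^ N‖ ≤ 1 := by
      rw [norm_pow]
      exact pow_le_one₀ (norm_nonneg _) (by
        rw [Real.norm_eq_abs, abs_le]; constructor <;> linarith [ht.1, ht.2])
    rw [norm_smul]
    refine (mul_le_of_le_one_left (norm_nonneg _) h1).trans ?_
    refine (ContinuousMultilinearMap.le_opNorm _ _).trans ?_
    simp only [Finset.prod_const, Finset.card_univ, Fintype.card_fin]
    gcongr
    exact hC _

lemma angularCoeff_taylor_isBigO {f : ℂ → ℂ} (hf : ContDiff ℝ (⊤ : ℕ∞) f)
    (hfc : HasCompactSupport f) (α N : ℕ) :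
    (fun r : ℝ => angularCoeff α f r - ∑ n ∈ Finset.range N,
      ((n.factorial : ℝ)⁻¹ • angularCoeff α (fun x => iteratedFDeriv ℝ n f 0 fun _ => x) 1) *
        (r : ℂ) ^ n) =O[nhdsWithin 0 (Set.Ioi 0)] fun r : ℝ => r ^ N := by
  obtain ⟨C, hC⟩ := exists_norm_taylor_remainder_le hf hfc N
  refine Asymptotics.IsBigO.of_bound (C * |Real.pi - -Real.pi|) ?_
  filter_upwards [self_mem_nhdsWithin] with r (hr : 0 < r)
  have h1 : angularCoeff α f r - ∑ n ∈ Finset.range N,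
      ((n.factorial : ℝ)⁻¹ • angularCoeff α (fun x => iteratedFDeriv ℝ n f 0 fun _ => x) 1) *
        (r : ℂ) ^ n = ∫ θ in -Real.pi..Real.pi,
      (f (r * Complex.exp (θ * Complex.I)) - ∑ n ∈ Finset.range N, (n.factorial : ℝ)⁻¹ •
        iteratedFDeriv ℝ n f 0 (fun _ => r * Complex.exp (θ * Complex.I))) *
        Complex.exp (((-α : ℤ) : ℂ) * Complex.I * θ) := by
    have hcf := hf.continuous
    simp_rw [sub_mul, Finset.sum_mul]
    rw [intervalIntegral.integral_sub, intervalIntegral.integral_finsetSum]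
    · unfold angularCoeff
      congr 1
      refine Finset.sum_congr rfl fun n _ => ?_
      rw [← intervalIntegral.integral_smul, ← intervalIntegral.integral_mul_const]
      congr 1
      ext θ
      have : (fun _ : Fin n => (r : ℂ) * Complex.exp (θ * Complex.I)) =
          fun i => r • (((1 : ℝ) : ℂ) * Complex.exp (θ * Complex.I)) := by
        ext; simp
      rw [this, ContinuousMultilinearMap.map_smul_univ]
      simp
      ring
    · intro n _
      exact Continuous.intervalIntegrable (by fun_prop) _ _
    · exact Continuous.intervalIntegrable (by fun_prop) _ _
    · exact Continuous.intervalIntegrable (by fun_prop) _ _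
  rw [h1]
  refine (intervalIntegral.norm_integral_le_of_norm_le_const (C := C * r ^ N)
      fun θ _ => ?_).trans (le_of_eq ?_)
  · rw [norm_mul]
    have h2 : ‖Complex.exp (((-α : ℤ) : ℂ) * Complex.I * θ)‖ = 1 := by
      rw [Complex.norm_exp]; simp
    rw [h2, mul_one]
    refine (hC _).trans (le_of_eq ?_)
    rw [norm_mul, Complex.norm_exp_ofReal_mul_I]
    simp [abs_of_pos hr]
  · rw [norm_pow, Real.norm_of_nonneg hr.le]; ring

/-- If `A` vanishes for large arguments and has an asymptotic expansion `∑ cₙ rⁿ` at `0⁺`, its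
Mellin transform extends meromorphically to `ℂ`, analytically past the `n` with `cₙ = 0`. -/
lemma exists_meromorphic_mellin {A : ℝ → ℂ} (hA : Continuous A) {M : ℝ}
    (hM : ∀ r, M < r → A r = 0) (c : ℕ → ℂ)
    (hc : ∀ N : ℕ, (fun r : ℝ => A r - ∑ n ∈ Finset.range N, c n * (r : ℂ) ^ n)
      =O[nhdsWithin 0 (Set.Ioi 0)] fun r : ℝ => r ^ N) :
    ∃ G : ℂ → ℂ, (∀ s, MeromorphicAt G s) ∧
      ∀ N : ℕ, (∀ n < N, c n = 0) → ∀ s : ℂ, -(N : ℝ) < s.re →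
        AnalyticAt ℂ G s ∧ MellinConvergent A s ∧ G s = mellin A s := by
  set u : ℕ → ℝ → ℂ := fun n => Set.indicator (Set.Ioc 0 1) (fun t : ℝ => (t : ℂ) ^ (n : ℂ))
    with hu
  set R : ℕ → ℝ → ℂ := fun N r => A r - ∑ n ∈ Finset.range N, c n • u n r with hR
  have hu_int : ∀ n, LocallyIntegrable (u n) := fun n => by
    refine Integrable.locallyIntegrable ?_
    rw [hu, integrable_indicator_iff measurableSet_Ioc]
    simp only [Complex.cpow_natCast]
    exact (Continuous.integrableOn_Icc (by fun_prop)).mono_set Set.Ioc_subset_Icc_self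
  have hR_int : ∀ N, LocallyIntegrableOn (R N) (Set.Ioi 0) := fun N => by
    refine LocallyIntegrable.locallyIntegrableOn ?_ _
    exact hA.locallyIntegrable.sub
      (locallyIntegrable_finsetSum _ fun n _ => (hu_int n).smul (c n))
  have hR_top : ∀ N (a : ℝ), R N =O[atTop] (· ^ (-a)) := fun N a => by
    refine Asymptotics.IsBigO.of_bound 1 ?_
    filter_upwards [eventually_gt_atTop M, eventually_gt_atTop 1] with r hr hr1
    have : R N r = 0 := by
      simp only [hR, hu, hM r hr, zero_sub, neg_eq_zero]
      refine Finset.sum_eq_zero fun n _ => ?_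
      rw [Set.indicator_of_notMem, smul_zero]
      simp [hr1]
    rw [this, norm_zero]
    positivity
  have hR_bot : ∀ N : ℕ, R N =O[nhdsWithin 0 (Set.Ioi 0)] (· ^ (-(-(N : ℝ)))) := fun N => by
    refine (hc N).congr' ?_ ?_
    · filter_upwards [Ioc_mem_nhdsGT (zero_lt_one (α := ℝ))] with r hr
      simp [hR, hu, hr]
    · filter_upwards with r
      simp
  have hdiff : ∀ N : ℕ, ∀ s : ℂ, -(N : ℝ) < s.re → DifferentiableAt ℂ (mellin (R N)) s :=
    fun N s hs => mellin_differentiableAt_of_isBigO_rpow (hR_int N) (hR_top N (s.re + 1))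
      (lt_add_one _) (hR_bot N) hs
  have hconv : ∀ N : ℕ, ∀ s : ℂ, -(N : ℝ) < s.re → MellinConvergent (R N) s :=
    fun N s hs => mellinConvergent_of_isBigO_rpow (hR_int N) (hR_top N (s.re + 1))
      (lt_add_one _) (hR_bot N) hs
  have hopen : ∀ N : ℕ, IsOpen {s : ℂ | -(N : ℝ) < s.re} := fun N =>
    isOpen_lt continuous_const Complex.continuous_re
  have han : ∀ N : ℕ, ∀ s : ℂ, -(N : ℝ) < s.re → AnalyticAt ℂ (mellin (R N)) s :=
    fun N s hs => DifferentiableOn.analyticAt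
      (fun z hz => (hdiff N z hz).differentiableWithinAt) ((hopen N).mem_nhds hs)
  set H : ℕ → ℂ → ℂ := fun N s => ∑ n ∈ Finset.range N, c n * (1 / (s + n)) + mellin (R N) s
    with hH
  have hstep : ∀ N : ℕ, ∀ s : ℂ, -(N : ℝ) < s.re → H N s = H (N + 1) s := by
    intro N s hs
    have h1 : HasMellin (u N) s (1 / (s + N)) := hasMellin_cpow_Ioc N (by simpa using by linarith)
    have h2 : R (N + 1) = fun t => R N t - c N • u N t := by
      ext t; simp only [hR, Finset.sum_range_succ]; ring
    have h3 := (hasMellin_sub (hconv N s hs) (hasMellin_const_smul h1.1 (c N)).1).2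
    rw [← h2, (hasMellin_const_smul h1.1 (c N)).2, h1.2] at h3
    simp only [hH, Finset.sum_range_succ, h3, smul_eq_mul]
    ring
  have hle : ∀ N K : ℕ, N ≤ K → ∀ s : ℂ, -(N : ℝ) < s.re → H N s = H K s := by
    intro N K hNK s hs
    induction K, hNK using Nat.le_induction with
    | base => rfl
    | succ K hK ih =>
      rw [ih]
      refine hstep K s ?_
      have : (N : ℝ) ≤ K := by exact_mod_cast hK
      linarith
  have hceil : ∀ s : ℂ, -((⌈-s.re⌉₊ + 1 : ℕ) : ℝ) < s.re := fun s => by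
    have := Nat.le_ceil (-s.re)
    push_cast
    linarith
  have hG : ∀ N : ℕ, ∀ s : ℂ, -(N : ℝ) < s.re → H (⌈-s.re⌉₊ + 1) s = H N s := fun N s hs => by
    rcases le_total N (⌈-s.re⌉₊ + 1) with h | h
    · exact (hle _ _ h s hs).symm
    · exact hle _ _ h s (hceil s)
  have hGev : ∀ N : ℕ, ∀ s : ℂ, -(N : ℝ) < s.re →
      (fun s => H (⌈-s.re⌉₊ + 1) s) =ᶠ[nhds s] H N := fun N s hs => by
    filter_upwards [(hopen N).mem_nhds hs] with z hz using hG N z hz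
  refine ⟨fun s => H (⌈-s.re⌉₊ + 1) s, fun s => ?_, fun N hN s hs => ?_⟩
  · refine MeromorphicAt.congr ?_ ((hGev _ s (hceil s)).symm.filter_mono nhdsWithin_le_nhds)
    refine MeromorphicAt.fun_add (MeromorphicAt.fun_sum fun n _ => ?_)
      (han _ s (hceil s)).meromorphicAt
    fun_prop
  · have h1 : H N = mellin (R N) := by
      ext z
      simp only [hH]
      rw [Finset.sum_eq_zero, zero_add]
      intro n hn
      rw [hN n (Finset.mem_range.mp hn), zero_mul]
    have h2 : R N = A := by
      ext r
      simp only [hR]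
      rw [Finset.sum_eq_zero, sub_zero]
      intro n hn
      rw [hN n (Finset.mem_range.mp hn), zero_smul]
    refine ⟨?_, h2 ▸ hconv N s hs, ?_⟩
    · refine AnalyticAt.congr ?_ (hGev N s hs).symm
      rw [h1]
      exact han N s hs
    · exact (hG N s hs).trans (by rw [h1, h2])

lemma integral_radial_mul_eq (α : ℕ) {φ : ℂ → ℂ} (hφ : Continuous φ) (hφc : HasCompactSupport φ)
    {M : ℝ} (hM : ∀ x, M < ‖x‖ → φ x = 0) {k : ℝ → ℂ}
    (hk : IntegrableOn (fun r : ℝ => (r : ℂ) * (k r / r ^ α)) (Set.Ioc 0 M)) :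
    ∫ x : ℂ, k ‖x‖ / x ^ α * φ x =
      ∫ r in Set.Ioi (0 : ℝ), (r : ℂ) * (k r / r ^ α) * angularCoeff α φ r := by
  rw [← Complex.integral_comp_polarCoord_symm]
  have htarget : polarCoord.target = Set.Ioi (0 : ℝ) ×ˢ Set.Ioo (-Real.pi) Real.pi := rfl
  set F : ℝ × ℝ → ℂ := fun p => ((p.1 : ℂ) * (k p.1 / p.1 ^ α)) *
    (φ (p.1 * Complex.exp (p.2 * Complex.I)) * Complex.exp (((-α : ℤ) : ℂ) * Complex.I * p.2))
    with hF
  have h1 : ∫ p in polarCoord.target, p.1 • (k ‖Complex.polarCoord.symm p‖ /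
      Complex.polarCoord.symm p ^ α * φ (Complex.polarCoord.symm p)) =
      ∫ p in Set.Ioi (0 : ℝ) ×ˢ Set.Ioo (-Real.pi) Real.pi, F p := by
    rw [htarget]
    refine setIntegral_congr_fun (measurableSet_Ioi.prod measurableSet_Ioo) fun p hp => ?_
    have hp0 : 0 < p.1 := hp.1
    have h2 : Complex.polarCoord.symm p = p.1 * Complex.exp (p.2 * Complex.I) := by
      rw [Complex.polarCoord_symm_apply, Complex.exp_mul_I]; simp
    have h3 : Complex.exp (((-α : ℤ) : ℂ) * Complex.I * p.2) =
        (Complex.exp (p.2 * Complex.I) ^ α)⁻¹ := by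
      rw [← Complex.exp_nat_mul, ← Complex.exp_neg]; congr 1; push_cast; ring
    simp only [hF]
    rw [Complex.norm_polarCoord_symm, abs_of_pos hp0, h2, h3, mul_pow, Complex.real_smul]
    field_simp
  have hzero : ∀ r : ℝ, 0 < r → M < r → ∀ θ : ℝ, φ (r * Complex.exp (θ * Complex.I)) = 0 :=
    fun r hr hMr θ => hM _ (by
      rwa [norm_mul, Complex.norm_exp_ofReal_mul_I, mul_one, Complex.norm_real,
        Real.norm_of_nonneg hr.le])
  have hint : IntegrableOn F (Set.Ioi (0 : ℝ) ×ˢ Set.Ioo (-Real.pi) Real.pi)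
      (volume.prod volume) := by
    obtain ⟨C, hC⟩ := hφc.exists_bound_of_continuous hφ
    have h2 : IntegrableOn F (Set.Ioc (0 : ℝ) M ×ˢ Set.Ioo (-Real.pi) Real.pi)
        (volume.prod volume) := by
      rw [IntegrableOn, ← Measure.prod_restrict]
      have h3 : Integrable (fun p : ℝ × ℝ => ((p.1 : ℂ) * (k p.1 / p.1 ^ α)) * (1 : ℂ))
          ((volume.restrict (Set.Ioc 0 M)).prod
            (volume.restrict (Set.Ioo (-Real.pi) Real.pi))) :=
        Integrable.mul_prod hk (integrable_const (1 : ℂ))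
      simp only [mul_one] at h3
      refine h3.mul_bdd (c := C) (Continuous.aestronglyMeasurable (by fun_prop))
        (ae_of_all _ fun p => ?_)
      have h4 : ‖Complex.exp (((-α : ℤ) : ℂ) * Complex.I * p.2)‖ = 1 := by
        rw [Complex.norm_exp]; simp
      rw [norm_mul, h4, mul_one]
      exact hC _
    refine h2.of_forall_sdiff_eq_zero (measurableSet_Ioi.prod measurableSet_Ioo) fun p hp => ?_
    have hp0 : 0 < p.1 := hp.1.1
    have hMp : M < p.1 := by
      by_contra! h
      exact hp.2 ⟨⟨hp0, h⟩, hp.1.2⟩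
    simp only [hF]
    rw [hzero _ hp0 hMp, zero_mul, mul_zero]
  rw [h1, Measure.volume_eq_prod, setIntegral_prod _ hint]
  refine setIntegral_congr_fun measurableSet_Ioi fun r _ => ?_
  simp only [hF, angularCoeff]
  rw [integral_const_mul, ← integral_Ioc_eq_integral_Ioo,
    ← intervalIntegral.integral_of_le (by linarith [Real.pi_pos])]

/-- the λ ↦ ∫_ℂ (|x|^{2λ}/x^α) φ dV, holomorphic for Re λ > α/2,
extends meromorphically to ℂ, is holomorphic near λ = 0, and its value at 0
is the principal value lim_{ε→0⁺} ∫_{|x|>ε} φ/x^α dV. -/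
theorem stmt0 (α : ℕ) (hα : 1 ≤ α) (φ : ℂ → ℂ)
    (hφ : ContDiff ℝ (⊤ : ℕ∞) φ) (hφc : HasCompactSupport φ) :
    ∃ g : ℂ → ℂ, MeromorphicOn g Set.univ ∧ AnalyticAt ℂ g 0 ∧
      (∀ l : ℂ, (α : ℝ) / 2 < l.re →
        g l = ∫ x : ℂ, (((‖x‖ ^ 2 : ℝ) : ℂ) ^ l / x ^ α) * φ x) ∧
      (∀ l : ℂ, (α : ℝ) / 2 < l.re → AnalyticAt ℂ g l) ∧
      Tendsto (fun ε : ℝ => ∫ x in {x : ℂ | ε < ‖x‖}, φ x / x ^ α)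
        (nhdsWithin 0 (Set.Ioi 0)) (nhds (g 0)) := by
  obtain ⟨M, hM⟩ : ∃ M : ℝ, ∀ x, M < ‖x‖ → φ x = 0 := by
    obtain ⟨M, hM⟩ := hφc.isCompact.isBounded.exists_norm_le
    refine ⟨M, fun x hx => ?_⟩
    by_contra h
    exact (hM x (subset_tsupport φ h)).not_gt hx
  have hMA : ∀ r, max M 0 < r → angularCoeff α φ r = 0 := by
    intro r hr
    have hr0 : 0 < r := (le_max_right _ _).trans_lt hr
    unfold angularCoeff
    rw [intervalIntegral.integral_congr (g := fun _ => 0), intervalIntegral.integral_zero]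
    intro θ _
    simp only
    rw [hM, zero_mul]
    rw [norm_mul, Complex.norm_exp_ofReal_mul_I, mul_one, Complex.norm_real,
      Real.norm_of_nonneg hr0.le]
    exact (le_max_left _ _).trans_lt hr
  obtain ⟨G, hmero, hG⟩ := exists_meromorphic_mellin
    (continuous_angularCoeff α hφ.continuous) hMA _ (angularCoeff_taylor_isBigO hφ hφc α)
  set s : ℂ → ℂ := fun l => 2 * l - α + 2 with hs
  have hs_an : ∀ l, AnalyticAt ℂ s l := fun l => by fun_prop
  have hG0 := hG α (fun n hn => by
    rw [angularCoeff_multilinear_eq_zero hn, smul_zero]) (s 0) (by simp [hs])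
  have hs_re : ∀ l : ℂ, (α : ℝ) / 2 < l.re → 2 < (s l).re := fun l hl => by
    simp [hs]; linarith
  have hGl : ∀ l : ℂ, (α : ℝ) / 2 < l.re → AnalyticAt ℂ G (s l) ∧
      MellinConvergent (angularCoeff α φ) (s l) ∧ G (s l) = mellin (angularCoeff α φ) (s l) :=
    fun l hl => hG 0 (by simp) (s l) (by
      have := hs_re l hl
      push_cast
      linarith)
  refine ⟨fun l => G (s l), fun l _ => (hmero (s l)).comp_analyticAt (hs_an l),
    hG0.1.comp (hs_an 0), fun l hl => ?_, fun l hl => (hGl l hl).1.comp (hs_an l), ?_⟩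
  · have hw : ∀ r : ℝ, 0 < r →
        (r : ℂ) * (((r ^ 2 : ℝ) : ℂ) ^ l / r ^ α) = (r : ℂ) ^ (s l - 1) := by
      intro r hr
      have hr' : (r : ℂ) ≠ 0 := by exact_mod_cast hr.ne'
      have h1 : ((r ^ 2 : ℝ) : ℂ) ^ l = (r : ℂ) ^ (2 * l) := by
        rw [sq, Complex.ofReal_mul, Complex.mul_cpow_ofReal_nonneg hr.le hr.le, two_mul,
          Complex.cpow_add _ _ hr']
      have h2 : s l - 1 = 1 + (2 * l - α) := by simp only [hs]; ring
      rw [h1, h2, Complex.cpow_add _ _ hr', Complex.cpow_sub _ _ hr', Complex.cpow_one,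
        Complex.cpow_natCast]
    beta_reduce
    rw [(hGl l hl).2.2, mellin, integral_radial_mul_eq α hφ.continuous hφc hM
      (k := fun r => ((r ^ 2 : ℝ) : ℂ) ^ l)]
    · refine setIntegral_congr_fun measurableSet_Ioi fun r hr => ?_
      simp only [hw r hr, smul_eq_mul]
    · refine IntegrableOn.congr_fun (f := fun r : ℝ => (r : ℂ) ^ (s l - 1)) ?_
        (fun r hr => (hw r hr.1).symm) measurableSet_Ioc
      rcases le_total M 0 with h | h
      · simp [Set.Ioc_eq_empty_of_le h]
      · rw [← intervalIntegrable_iff_integrableOn_Ioc_of_le h]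
        refine intervalIntegral.intervalIntegrable_cpow' ?_
        have := hs_re l hl
        simp only [Complex.sub_re, Complex.one_re]
        linarith
  · have hw : ∀ r : ℝ, 0 < r → (r : ℂ) * (1 / r ^ α) = (r : ℂ) ^ (s 0 - 1) := by
      intro r hr
      have hr' : (r : ℂ) ≠ 0 := by exact_mod_cast hr.ne'
      have h2 : s 0 - 1 = 1 - α := by simp only [hs]; ring
      rw [h2, Complex.cpow_sub _ _ hr', Complex.cpow_one, Complex.cpow_natCast, mul_one_div]
    have hpv : ∀ ε : ℝ, 0 < ε → ∫ x in {x : ℂ | ε < ‖x‖}, φ x / x ^ α =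
        ∫ r in Set.Ioi (0 : ℝ), Set.indicator (Set.Ioi ε)
          (fun r : ℝ => (r : ℂ) ^ (s 0 - 1) • angularCoeff α φ r) r := by
      intro ε hε
      have hmeas : MeasurableSet {x : ℂ | ε < ‖x‖} :=
        (isOpen_lt continuous_const continuous_norm).measurableSet
      rw [← integral_indicator hmeas]
      have h1 := integral_radial_mul_eq α hφ.continuous hφc hM
        (k := Set.indicator (Set.Ioi ε) fun _ => 1) (by
          have h2 : IntegrableOn (fun r : ℝ => (r : ℂ) * (1 / r ^ α)) (Set.Icc ε M) := by
            refine ContinuousOn.integrableOn_Icc fun r hr => ?_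
            have : (r : ℂ) ^ α ≠ 0 := pow_ne_zero _ (by exact_mod_cast (hε.trans_le hr.1).ne')
            exact ContinuousAt.continuousWithinAt (by fun_prop (disch := assumption))
          have h3 : IntegrableOn (Set.indicator (Set.Ioi ε)
              fun r : ℝ => (r : ℂ) * (1 / r ^ α)) (Set.Ioc 0 M) := by
            rw [IntegrableOn, integrable_indicator_iff measurableSet_Ioi, IntegrableOn,
              Measure.restrict_restrict measurableSet_Ioi]
            exact h2.mono_set fun r hr => ⟨le_of_lt hr.1, hr.2.2⟩
          refine h3.congr_fun (fun r _ => ?_) measurableSet_Ioc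
          by_cases h : r ∈ Set.Ioi ε <;> simp [h])
      convert h1 using 1
      · congr 1
        ext x
        by_cases h : ε < ‖x‖
        · simp [h]; ring
        · simp [h]
      · refine setIntegral_congr_fun measurableSet_Ioi fun r hr => ?_
        by_cases h : ε < r
        · simp only [Set.indicator_of_mem (Set.mem_Ioi.mpr h), hw r hr, smul_eq_mul]
        · simp [h]
    beta_reduce
    rw [hG0.2.2, mellin]
    refine Tendsto.congr' (f₁ := fun ε : ℝ => ∫ r in Set.Ioi (0 : ℝ), Set.indicator (Set.Ioi ε)
      (fun r : ℝ => (r : ℂ) ^ (s 0 - 1) • angularCoeff α φ r) r) ?_ ?_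
    · filter_upwards [self_mem_nhdsWithin] with ε hε using (hpv ε hε).symm
    · refine tendsto_integral_filter_of_dominated_convergence
        (fun r : ℝ => ‖(r : ℂ) ^ (s 0 - 1) • angularCoeff α φ r‖) ?_ ?_ hG0.2.1.norm ?_
      · exact Eventually.of_forall fun ε =>
          hG0.2.1.aestronglyMeasurable.indicator measurableSet_Ioi
      · exact Eventually.of_forall fun ε => ae_of_all _ fun r => norm_indicator_le_norm_self _ _
      · filter_upwards [ae_restrict_mem measurableSet_Ioi] with r hr
        refine tendsto_const_nhds.congr' ?_
        filter_upwards [mem_nhdsWithin_of_mem_nhds (Iio_mem_nhds hr)] with ε hε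
        rw [Set.indicator_of_mem (Set.mem_Ioi.mpr hε)]
end

section
/- Let r_1, …, r_n be polar radii and α_1, …, α_p ∈ ℕ^n multiindices with linearly independent rows, let χ : [0,∞) → [0,1] be smooth, 0 near 0 and 1 near ∞, and let 𝒥 be a smooth compactly supported function on [0,1]^n. Set χ_j^ε(r) = χ(r^{2α_j}/ε_j) and I(ε) = ∫_{(0,1)^n} dχ_1^ε ∧ ⋯ ∧ dχ_p^ε · 𝒥(r) dr_M with |M| = n − p, M ⊂ {1,…,n}. Then the limit lim I(ε) as ε_1 ≪ ⋯ ≪ ε_p → 0 (i.e., along any sequence with ε_{j−1} ≤ C_{jk} ε_j^k for all k, allowing some ε_j to reach and stay at 0 via iterated limits) exists, and it equals either ± ∫_{r_M ∈ (0,1)^{n−p}} 𝒥(0, r_M) dr_M or 0, with the choice (and sign) depending only on the exponent matrix (α_{ji}) and M, not on χ or 𝒥. -/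
open Filter MeasureTheory Finset

/-- The functions `L · j` tend to infinity, each one negligible against all the earlier ones. -/
def LexGrowing {X : Type*} {p : ℕ} (l : Filter X) (L : X → Fin p → ℝ) : Prop :=
  (∀ j, Tendsto (fun x => L x j) l atTop) ∧
    ∀ j k, j < k → (fun x => L x k) =o[l] fun x => L x j

/-- A nonzero linear form in lexicographically growing functions tends to `±∞`, the sign being
that of its first nonzero coefficient. -/
lemma tendsto_sum_lexGrowing_or {X : Type*} {p : ℕ} {b : Fin p → ℝ} (hb : b ≠ 0) :
    (∀ (l : Filter X) (L : X → Fin p → ℝ), LexGrowing l L →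
      Tendsto (fun x => ∑ j, b j * L x j) l atTop) ∨
    (∀ (l : Filter X) (L : X → Fin p → ℝ), LexGrowing l L →
      Tendsto (fun x => ∑ j, b j * L x j) l atBot) := by
  classical
  obtain ⟨i, hi⟩ := Function.ne_iff.mp hb
  have hne : (univ.filter fun j => b j ≠ 0).Nonempty := ⟨i, by simpa using hi⟩
  set k := (univ.filter fun j => b j ≠ 0).min' hne with hk
  have hk0 : b k ≠ 0 := by
    have := Finset.min'_mem _ hne
    simpa using this
  have hlt : ∀ j, j < k → b j = 0 := by
    intro j hj
    by_contra h
    exact absurd (Finset.min'_le (univ.filter fun j => b j ≠ 0) j (by simpa using h)) (not_le.2 hj)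
  have key : ∀ (l : Filter X) (L : X → Fin p → ℝ), LexGrowing l L →
      Asymptotics.IsEquivalent l (fun x => ∑ j, b j * L x j) (fun x => b k * L x k) := by
    intro l L hL
    have h1 : (fun x => ∑ j ∈ univ.erase k, b j * L x j) =o[l] fun x => b k * L x k := by
      refine Asymptotics.IsLittleO.fun_sum fun j hj => ?_
      rcases lt_or_gt_of_ne (Finset.ne_of_mem_erase hj) with h | h
      · simp [hlt j h]
      · exact ((hL.2 k j h).const_mul_left _).const_mul_right hk0
    have h2 : Asymptotics.IsEquivalent l
        ((fun x => b k * L x k) + fun x => ∑ j ∈ univ.erase k, b j * L x j)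
        (fun x => b k * L x k) := Asymptotics.IsEquivalent.refl.add_isLittleO h1
    refine h2.congr_left (Eventually.of_forall fun x => ?_)
    exact Finset.add_sum_erase univ (fun j => b j * L x j) (mem_univ k)
  rcases lt_or_gt_of_ne hk0 with h | h
  · exact .inr fun l L hL => (key l L hL).symm.tendsto_atBot ((hL.1 k).const_mul_atTop_of_neg h)
  · exact .inl fun l L hL => (key l L hL).symm.tendsto_atTop ((hL.1 k).const_mul_atTop h)

/-- Powers of positive functions tending to `0` dominating one another give lexicographically
growing logarithms. -/
lemma lexGrowing_neg_log {X : Type*} {p : ℕ} {l : Filter X} {ε : X → Fin p → ℝ}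
    (hpos : ∀ᶠ x in l, ∀ j, 0 < ε x j) (h0 : ∀ j, Tendsto (fun x => ε x j) l (nhds 0))
    (hdom : ∀ (k : ℕ) (j : Fin p) (hj : (j : ℕ) + 1 < p), ∃ C : ℝ,
      ∀ᶠ x in l, ε x j ≤ C * ε x ⟨(j : ℕ) + 1, hj⟩ ^ k) :
    LexGrowing l fun x j => -Real.log (ε x j) := by
  have htop : ∀ j, Tendsto (fun x => -Real.log (ε x j)) l atTop := by
    intro j
    refine tendsto_neg_atBot_atTop.comp (Real.tendsto_log_nhdsGT_zero.comp ?_)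
    exact tendsto_nhdsWithin_iff.2 ⟨h0 j, hpos.mono fun x hx => hx j⟩
  have hstep : ∀ (j : Fin p) (hj : (j : ℕ) + 1 < p),
      (fun x => -Real.log (ε x ⟨(j : ℕ) + 1, hj⟩)) =o[l] fun x => -Real.log (ε x j) := by
    intro j hj
    rw [Asymptotics.isLittleO_iff]
    intro c hc
    obtain ⟨k, hk⟩ := exists_nat_gt (1 / c)
    have hkpos : (0 : ℝ) < k := (by positivity : 0 < 1 / c).trans hk
    obtain ⟨C, hC⟩ := hdom (k + 1) j hj
    have hgt := (htop ⟨(j : ℕ) + 1, hj⟩).eventually_ge_atTop (max (Real.log C) 0)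
    filter_upwards [hpos, hC, hgt, (htop j).eventually_ge_atTop 0] with x hx hxC hx1 hx2
    have ha := hx j
    have hb := hx ⟨(j : ℕ) + 1, hj⟩
    have hCpos : 0 < C := by
      by_contra h
      have : C * ε x ⟨(j : ℕ) + 1, hj⟩ ^ (k + 1) ≤ 0 :=
        mul_nonpos_of_nonpos_of_nonneg (not_lt.1 h) (by positivity)
      linarith
    have hlog := Real.log_le_log ha hxC
    rw [Real.log_mul hCpos.ne' (by positivity), Real.log_pow] at hlog
    have hm1 := (le_max_left _ _).trans hx1
    have hm2 := (le_max_right _ _).trans hx1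
    rw [Real.norm_of_nonneg hm2, Real.norm_of_nonneg hx2]
    push_cast at hlog
    have h3 : (k : ℝ) * -Real.log (ε x ⟨(j : ℕ) + 1, hj⟩) ≤ -Real.log (ε x j) := by linarith
    have h4 : 1 ≤ c * k := by
      have := (div_lt_iff₀' hc).1 hk
      linarith
    calc -Real.log (ε x ⟨(j : ℕ) + 1, hj⟩)
        ≤ (c * k) * -Real.log (ε x ⟨(j : ℕ) + 1, hj⟩) := le_mul_of_one_le_left hm2 h4
      _ = c * (k * -Real.log (ε x ⟨(j : ℕ) + 1, hj⟩)) := by ring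
      _ ≤ c * -Real.log (ε x j) := by gcongr
  refine ⟨htop, ?_⟩
  have main : ∀ (d : ℕ) (j : Fin p) (hd : (j : ℕ) + (d + 1) < p),
      (fun x => -Real.log (ε x ⟨(j : ℕ) + (d + 1), hd⟩)) =o[l] fun x => -Real.log (ε x j) := by
    intro d
    induction d with
    | zero => exact fun j hd => hstep j hd
    | succ d ih =>
      intro j hd
      exact (hstep ⟨(j : ℕ) + (d + 1), by omega⟩ hd).trans (ih j (by omega))
  intro j k hjk
  obtain ⟨d, hd⟩ := Nat.exists_eq_add_of_lt (Fin.lt_def.1 hjk)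
  have : k = ⟨(j : ℕ) + (d + 1), by omega⟩ := Fin.ext (by simp; omega)
  rw [this]
  exact main d j _

lemma hasFDerivAt_prod_pow {κ : Type*} [Fintype κ] (m : κ → ℕ) {s : κ → ℝ}
    (hs : ∀ i, 0 < s i) :
    HasFDerivAt (fun s : κ → ℝ => ∏ i, s i ^ m i)
      (∑ i, (m i * (∏ k, s k ^ m k) / s i) •
        ContinuousLinearMap.proj (R := ℝ) (φ := fun _ : κ => ℝ) i) s := by
  classical
  have h : ∀ i ∈ (univ : Finset κ), HasFDerivAt (fun s : κ → ℝ => s i ^ m i)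
      ((m i * s i ^ (m i - 1)) •
        ContinuousLinearMap.proj (R := ℝ) (φ := fun _ : κ => ℝ) i) s := by
    intro i _
    have := (hasFDerivAt_apply (𝕜 := ℝ) i s).pow (m i)
    simpa using this
  refine (HasFDerivAt.finsetProd h).congr_fderiv ?_
  refine Finset.sum_congr rfl fun i _ => ?_
  rw [smul_smul]
  congr 1
  rw [← Finset.mul_prod_erase univ (fun k => s k ^ m k) (mem_univ i)]
  have := (hs i).ne'
  rcases Nat.eq_zero_or_pos (m i) with h0 | h0
  · simp [h0]
  · obtain ⟨q, hq⟩ := Nat.exists_eq_succ_of_ne_zero h0.ne'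
    rw [hq]
    simp only [Nat.succ_eq_add_one, Nat.add_sub_cancel, pow_succ]
    field_simp

section MonomialMap

variable {ι : Type*} [Fintype ι]

/-- The map with monomial components `c j * ∏ i, s i ^ m j i`. -/
def monomialMap (m : ι → ι → ℕ) (c : ι → ℝ) (s : ι → ℝ) : ι → ℝ :=
  fun j => c j * ∏ i, s i ^ m j i

/-- The Jacobian matrix of `monomialMap m c` at a point with positive coordinates. -/
noncomputable def monomialJacobian (m : ι → ι → ℕ) (c : ι → ℝ) (s : ι → ℝ) : Matrix ι ι ℝ :=
  Matrix.of fun j i => c j * (m j i * (∏ k, s k ^ m j k) / s i)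

/-- The exponents of `monomialMap` as a real matrix. -/
def exponentMatrix (m : ι → ι → ℕ) : Matrix ι ι ℝ := Matrix.of fun j i => (m j i : ℝ)

lemma monomialMap_pos {m : ι → ι → ℕ} {c s : ι → ℝ} (hc : ∀ j, 0 < c j) (hs : ∀ i, 0 < s i)
    (j : ι) : 0 < monomialMap m c s j :=
  mul_pos (hc j) (Finset.prod_pos fun i _ => pow_pos (hs i) _)

lemma log_monomialMap {m : ι → ι → ℕ} {c s : ι → ℝ} (hc : ∀ j, 0 < c j) (hs : ∀ i, 0 < s i)
    (j : ι) : Real.log (monomialMap m c s j) =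
      Real.log (c j) + ((exponentMatrix m).mulVec fun i => Real.log (s i)) j := by
  rw [monomialMap, Real.log_mul (hc j).ne' (Finset.prod_pos fun i _ => pow_pos (hs i) _).ne',
    Real.log_prod (fun i _ => (pow_pos (hs i) _).ne')]
  simp [Matrix.mulVec, dotProduct, exponentMatrix]

variable [DecidableEq ι]

/-- The inverse of `monomialMap m c` on points with positive coordinates. -/
noncomputable def monomialInv (m : ι → ι → ℕ) (c : ι → ℝ) (t : ι → ℝ) : ι → ℝ :=
  fun i => Real.exp (∑ j, (exponentMatrix m)⁻¹ i j * (Real.log (t j) - Real.log (c j)))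

lemma det_monomialJacobian (m : ι → ι → ℕ) (c s : ι → ℝ) :
    (monomialJacobian m c s).det =
      (∏ j, monomialMap m c s j) * ((∏ i, (s i)⁻¹) * (exponentMatrix m).det) := by
  rw [← Matrix.det_mul_row, ← Matrix.det_mul_column]
  congr 1
  ext j i
  simp only [monomialJacobian, monomialMap, exponentMatrix, Matrix.of_apply]
  ring

lemma monomialInv_monomialMap {m : ι → ι → ℕ} (hm : (exponentMatrix m).det ≠ 0) {c s : ι → ℝ}
    (hc : ∀ j, 0 < c j) (hs : ∀ i, 0 < s i) : monomialInv m c (monomialMap m c s) = s := by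
  ext i
  simp only [monomialInv, log_monomialMap hc hs, add_sub_cancel_left]
  have : ((exponentMatrix m)⁻¹.mulVec ((exponentMatrix m).mulVec fun i => Real.log (s i))) i =
      Real.log (s i) := by
    rw [Matrix.mulVec_mulVec, Matrix.nonsing_inv_mul _ (isUnit_iff_ne_zero.2 hm),
      Matrix.one_mulVec]
  rw [Matrix.mulVec, dotProduct] at this
  rw [this, Real.exp_log (hs i)]

lemma monomialMap_monomialInv {m : ι → ι → ℕ} (hm : (exponentMatrix m).det ≠ 0) {c t : ι → ℝ}
    (hc : ∀ j, 0 < c j) (ht : ∀ i, 0 < t i) : monomialMap m c (monomialInv m c t) = t := by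
  have hpos : ∀ i, 0 < monomialInv m c t i := fun i => Real.exp_pos _
  ext j
  refine Real.log_injOn_pos (monomialMap_pos hc hpos j) (ht j) ?_
  rw [log_monomialMap hc hpos]
  have : (fun i => Real.log (monomialInv m c t i)) =
      (exponentMatrix m)⁻¹.mulVec fun j => Real.log (t j) - Real.log (c j) := by
    ext i
    simp [monomialInv, Matrix.mulVec, dotProduct]
  rw [this, Matrix.mulVec_mulVec, Matrix.mul_nonsing_inv _ (isUnit_iff_ne_zero.2 hm),
    Matrix.one_mulVec]
  ring

lemma measurable_monomialInv (m : ι → ι → ℕ) (c : ι → ℝ) : Measurable (monomialInv m c) := by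
  unfold monomialInv
  fun_prop

lemma hasFDerivAt_monomialMap (m : ι → ι → ℕ) (c : ι → ℝ) {s : ι → ℝ} (hs : ∀ i, 0 < s i) :
    HasFDerivAt (monomialMap m c)
      (LinearMap.toContinuousLinearMap (Matrix.toLin' (monomialJacobian m c s))) s := by
  rw [hasFDerivAt_pi']
  intro j
  refine ((hasFDerivAt_prod_pow (m j) hs).const_mul (c j)).congr_fderiv ?_
  ext v
  simp [monomialJacobian, Matrix.mulVec, dotProduct, Finset.mul_sum, mul_assoc]

/-- Change of variables along a monomial map on the unit cube. -/
lemma setIntegral_monomialMap {m : ι → ι → ℕ} (hm : (exponentMatrix m).det ≠ 0) {c : ι → ℝ}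
    (hc : ∀ j, 0 < c j) (u g : (ι → ℝ) → ℝ) :
    ∫ s in Set.pi Set.univ fun _ : ι => Set.Ioo (0 : ℝ) 1,
        u (monomialMap m c s) * (monomialJacobian m c s).det * g s =
      SignType.sign (exponentMatrix m).det *
        ∫ t in Set.pi Set.univ fun _ : ι => Set.Ioi (0 : ℝ),
          u t * (Set.pi Set.univ fun _ : ι => Set.Ioo (0 : ℝ) 1).indicator g
            (monomialInv m c t) := by
  set P : Set (ι → ℝ) := Set.pi Set.univ fun _ : ι => Set.Ioi (0 : ℝ) with hP
  set Q : Set (ι → ℝ) := Set.pi Set.univ fun _ : ι => Set.Ioo (0 : ℝ) 1 with hQ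
  have hPm : MeasurableSet P := MeasurableSet.univ_pi fun _ => measurableSet_Ioi
  have hQm : MeasurableSet Q := MeasurableSet.univ_pi fun _ => measurableSet_Ioo
  have hQP : Q ⊆ P := Set.pi_mono fun _ _ => Set.Ioo_subset_Ioi_self
  have hmem : ∀ s ∈ P, ∀ i, 0 < s i := fun s hs i => hs i trivial
  have himg : monomialMap m c '' P = P := by
    ext t
    constructor
    · rintro ⟨s, hs, rfl⟩
      exact fun j _ => monomialMap_pos hc (hmem s hs) j
    · intro ht
      exact ⟨monomialInv m c t, fun i _ => Real.exp_pos _, monomialMap_monomialInv hm hc (hmem t ht)⟩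
  have hinj : Set.InjOn (monomialMap m c) P := by
    intro s hs s' hs' h
    rw [← monomialInv_monomialMap hm hc (hmem s hs), h,
      monomialInv_monomialMap hm hc (hmem s' hs')]
  have hcov := integral_image_eq_integral_abs_det_fderiv_smul (volume : Measure (ι → ℝ)) hPm
    (fun s hs => (hasFDerivAt_monomialMap m c (hmem s hs)).hasFDerivWithinAt) hinj
    (fun t => u t * Q.indicator g (monomialInv m c t))
  rw [himg] at hcov
  have hind (F : (ι → ℝ) → ℝ) : ∫ s in Q, F s = ∫ s in P, Q.indicator F s := by
    rw [setIntegral_indicator hQm, Set.inter_eq_self_of_subset_right hQP]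
  rw [hcov, ← integral_const_mul, hind]
  refine setIntegral_congr_fun hPm fun s hs => ?_
  have hs' := hmem s hs
  simp only [smul_eq_mul, monomialInv_monomialMap hm hc hs']
  by_cases hsQ : s ∈ Q
  · simp only [Set.indicator_of_mem hsQ, ContinuousLinearMap.det,
      LinearMap.coe_toContinuousLinearMap, LinearMap.det_toLin']
    have hpos : 0 < (∏ j, monomialMap m c s j) * ∏ i, (s i)⁻¹ :=
      mul_pos (Finset.prod_pos fun j _ => monomialMap_pos hc hs' j)
        (Finset.prod_pos fun i _ => inv_pos.2 (hs' i))
    rw [det_monomialJacobian, ← mul_assoc (∏ j, _), abs_mul, abs_of_pos hpos]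
    have := sign_mul_abs (exponentMatrix m).det
    linear_combination
      -(u (monomialMap m c s) * ((∏ j, monomialMap m c s j) * ∏ i, (s i)⁻¹) * g s) * this
  · simp [Set.indicator_of_notMem hsQ]

end MonomialMap

/-- A smooth function that is `0` near `0` and `1` near `∞` has derivative integrable on the
positive half line, of integral `1`. -/
lemma integrableOn_deriv_and_integral_eq_one {χ : ℝ → ℝ} (hχ : ContDiff ℝ (⊤ : ℕ∞) χ)
    (h0 : ∀ᶠ t in nhds 0, χ t = 0) (h1 : ∀ᶠ t in atTop, χ t = 1) :
    IntegrableOn (deriv χ) (Set.Ioi 0) ∧ ∫ t in Set.Ioi (0 : ℝ), deriv χ t = 1 := by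
  have hd : Differentiable ℝ χ := hχ.differentiable (by simp)
  have hcont : Continuous (deriv χ) := hχ.continuous_deriv (by simp)
  obtain ⟨b, hb⟩ := eventually_atTop.1 h1
  have hzero : ∀ t ∈ Set.Ioi (max b 0), deriv χ t = 0 := by
    intro t ht
    have : χ =ᶠ[nhds t] fun _ => 1 := by
      filter_upwards [Ioi_mem_nhds ((le_max_left b 0).trans_lt ht)] with x hx
      exact hb x (le_of_lt hx)
    rw [this.deriv_eq]
    simp
  have hint : IntegrableOn (deriv χ) (Set.Ioi 0) := by
    rw [← Set.Ioc_union_Ioi_eq_Ioi (le_max_right b 0)]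
    refine IntegrableOn.union ?_ ?_
    · exact (hcont.continuousOn.integrableOn_compact isCompact_Icc).mono_set
        Set.Ioc_subset_Icc_self
    · exact (integrableOn_congr_fun hzero measurableSet_Ioi).2 integrableOn_zero
  refine ⟨hint, ?_⟩
  rw [integral_Ioi_of_hasDerivAt_of_tendsto' (m := 1) (f := χ) (fun t _ => (hd t).hasDerivAt) hint
    (tendsto_const_nhds.congr' (h1.mono fun t ht => ht.symm)), h0.self_of_nhds, sub_zero]

lemma restrict_pi_Ioi {ι : Type*} [Fintype ι] :
    (volume : Measure (ι → ℝ)).restrict (Set.pi Set.univ fun _ : ι => Set.Ioi (0 : ℝ)) =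
      Measure.pi fun _ : ι => (volume : Measure ℝ).restrict (Set.Ioi 0) := by
  rw [volume_pi, Measure.restrict_pi_pi]

lemma integrable_prod_deriv {ι : Type*} [Fintype ι] {χ : ℝ → ℝ}
    (hint : IntegrableOn (deriv χ) (Set.Ioi 0)) :
    IntegrableOn (fun t : ι → ℝ => ∏ j, deriv χ (t j))
      (Set.pi Set.univ fun _ : ι => Set.Ioi (0 : ℝ)) := by
  rw [IntegrableOn, restrict_pi_Ioi]
  exact Integrable.fintype_prod (f := fun _ : ι => deriv χ) fun _ => hint

lemma norm_setIntegral_monomialMap_le {ι : Type*} [Fintype ι] [DecidableEq ι] (m : ι → ι → ℕ)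
    {c : ι → ℝ} (hc : ∀ j, 0 < c j) {χ : ℝ → ℝ} (hint : IntegrableOn (deriv χ) (Set.Ioi 0))
    {g : (ι → ℝ) → ℝ} {K : ℝ} (hK : ∀ s, ‖g s‖ ≤ K) :
    ‖∫ s in Set.pi Set.univ fun _ : ι => Set.Ioo (0 : ℝ) 1,
        (∏ j, deriv χ (monomialMap m c s j)) * (monomialJacobian m c s).det * g s‖ ≤
      ∫ t in Set.pi Set.univ fun _ : ι => Set.Ioi (0 : ℝ), ‖∏ j, deriv χ (t j)‖ * K := by
  have hK0 : 0 ≤ K := (norm_nonneg _).trans (hK 0)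
  by_cases hm : (exponentMatrix m).det = 0
  · simp only [det_monomialJacobian, hm, mul_zero, zero_mul, integral_zero, norm_zero]
    exact integral_nonneg fun t => by positivity
  · rw [setIntegral_monomialMap hm hc (fun t => ∏ j, deriv χ (t j)) g, norm_mul]
    have hs : ‖((SignType.sign (exponentMatrix m).det : SignType) : ℝ)‖ ≤ 1 := by
      rcases SignType.sign (exponentMatrix m).det <;> simp
    refine (mul_le_of_le_one_left (norm_nonneg _) hs).trans ?_
    refine norm_integral_le_of_norm_le ((integrable_prod_deriv hint).norm.mul_const K) ?_
    refine Eventually.of_forall fun t => ?_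
    rw [norm_mul]
    gcongr
    refine (norm_indicator_le_norm_self _ _).trans (hK _)

/-- The limit in the case where the number of functions equals the number of variables. -/
lemma exists_tendsto_setIntegral_monomialMap {p : ℕ} (m : Fin p → Fin p → ℕ) :
    ∃ c : ℝ, (c = 1 ∨ c = -1 ∨ c = 0) ∧
      ∀ χ : ℝ → ℝ, ContDiff ℝ (⊤ : ℕ∞) χ →
        (∀ᶠ t in nhds 0, χ t = 0) → (∀ᶠ t in atTop, χ t = 1) →
      ∀ g : (Fin p → ℝ) → ℝ, Continuous g → ∀ K : ℝ, (∀ s, ‖g s‖ ≤ K) →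
      ∀ (l : Filter ℝ) [l.IsCountablyGenerated] (ε : ℝ → Fin p → ℝ),
        (∀ᶠ δ in l, ∀ j, 0 < ε δ j) → LexGrowing l (fun δ j => -Real.log (ε δ j)) →
      ∀ b : Fin p → ℝ, (∀ j, 0 < b j) →
        Tendsto (fun δ => ∫ s in Set.pi Set.univ fun _ : Fin p => Set.Ioo (0 : ℝ) 1,
          (∏ j, deriv χ (monomialMap m (fun j => b j / ε δ j) s j)) *
            (monomialJacobian m (fun j => b j / ε δ j) s).det * g s) l (nhds (c * g 0)) := by
  by_cases hm : (exponentMatrix m).det = 0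
  · refine ⟨0, by simp, ?_⟩
    intros
    simp [det_monomialJacobian, hm, tendsto_const_nhds]
  set B := (exponentMatrix m)⁻¹ with hB
  have hrow : ∀ i, B i ≠ 0 := by
    intro i hi
    have h1 : B * exponentMatrix m = 1 := Matrix.nonsing_inv_mul _ (isUnit_iff_ne_zero.2 hm)
    have h2 := congrFun (congrFun h1 i) i
    rw [Matrix.mul_apply] at h2
    simp [hi] at h2
  set σ : ℝ := ((SignType.sign (exponentMatrix m).det : SignType) : ℝ) with hσ
  have hσ3 : σ = 1 ∨ σ = -1 ∨ σ = 0 := by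
    rw [hσ]
    rcases SignType.sign (exponentMatrix m).det <;> simp
  have hlog : ∀ (b ε t : Fin p → ℝ), (∀ j, 0 < b j) → (∀ j, 0 < ε j) → ∀ i,
      ∑ j, B i j * (Real.log (t j) - Real.log (b j / ε j)) =
        ∑ j, B i j * (Real.log (t j) - Real.log (b j)) + -∑ j, B i j * -Real.log (ε j) := by
    intro b ε t hb hε i
    rw [← sub_eq_add_neg, ← Finset.sum_sub_distrib]
    refine Finset.sum_congr rfl fun j _ => ?_
    rw [Real.log_div (hb j).ne' (hε j).ne']
    ring
  set Q : Set (Fin p → ℝ) := Set.pi Set.univ fun _ => Set.Ioo (0 : ℝ) 1 with hQ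
  have hQm : MeasurableSet Q := MeasurableSet.univ_pi fun _ => measurableSet_Ioo
  have reduce : ∀ (d : ℝ) (χ : ℝ → ℝ), ContDiff ℝ (⊤ : ℕ∞) χ →
        (∀ᶠ t in nhds 0, χ t = 0) → (∀ᶠ t in atTop, χ t = 1) →
      ∀ g : (Fin p → ℝ) → ℝ, Continuous g → ∀ K : ℝ, (∀ s, ‖g s‖ ≤ K) →
      ∀ (l : Filter ℝ) [l.IsCountablyGenerated] (ε : ℝ → Fin p → ℝ),
        (∀ᶠ δ in l, ∀ j, 0 < ε δ j) →
      ∀ b : Fin p → ℝ, (∀ j, 0 < b j) →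
        (∀ t, Tendsto (fun δ => Q.indicator g (monomialInv m (fun j => b j / ε δ j) t)) l
          (nhds (d * g 0))) →
        Tendsto (fun δ => ∫ s in Q,
          (∏ j, deriv χ (monomialMap m (fun j => b j / ε δ j) s j)) *
            (monomialJacobian m (fun j => b j / ε δ j) s).det * g s) l
          (nhds (σ * d * g 0)) := by
    intro d χ hχ h0 h1 g hg K hK l _ ε hε b hb hlim
    obtain ⟨hint, hone⟩ := integrableOn_deriv_and_integral_eq_one hχ h0 h1
    have hval : ∫ t in Set.pi Set.univ fun _ : Fin p => Set.Ioi (0 : ℝ),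
        (∏ j, deriv χ (t j)) * (d * g 0) = d * g 0 := by
      rw [integral_mul_const, restrict_pi_Ioi,
        integral_fintype_prod_eq_prod (f := fun _ : Fin p => deriv χ)]
      simp [hone]
    have hDCT := tendsto_integral_filter_of_dominated_convergence
      (μ := volume.restrict (Set.pi Set.univ fun _ : Fin p => Set.Ioi (0 : ℝ))) (l := l)
      (F := fun δ t => (∏ j, deriv χ (t j)) *
        Q.indicator g (monomialInv m (fun j => b j / ε δ j) t))
      (f := fun t => (∏ j, deriv χ (t j)) * (d * g 0))
      (fun t => ‖∏ j, deriv χ (t j)‖ * K)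
      (Eventually.of_forall fun δ => by
        have h2 : Measurable (Q.indicator g) := hg.measurable.indicator hQm
        have h3 : Measurable (deriv χ) := measurable_deriv χ
        exact ((Finset.measurable_fun_prod _ fun j _ => h3.comp (measurable_pi_apply j)).mul
          (h2.comp (measurable_monomialInv m _))).aestronglyMeasurable)
      (Eventually.of_forall fun δ => Eventually.of_forall fun t => by
        rw [norm_mul]
        gcongr
        exact (norm_indicator_le_norm_self _ _).trans (hK _))
      ((integrable_prod_deriv hint).norm.mul_const K)
      (Eventually.of_forall fun t => (hlim t).const_mul _)
    rw [hval] at hDCT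
    rw [mul_assoc]
    refine (hDCT.const_mul σ).congr' ?_
    filter_upwards [hε] with δ hδ
    exact (setIntegral_monomialMap hm (fun j => div_pos (hb j) (hδ j))
      (fun t => ∏ j, deriv χ (t j)) g).symm
  by_cases hpos : ∀ i, ∀ (l : Filter ℝ) (L : ℝ → Fin p → ℝ), LexGrowing l L →
      Tendsto (fun x => ∑ j, B i j * L x j) l atTop
  · refine ⟨σ, hσ3, ?_⟩
    intro χ hχ h0 h1 g hg K hK l _ ε hε hL b hb
    rw [← mul_one σ]
    refine reduce 1 χ hχ h0 h1 g hg K hK l ε hε b hb fun t => ?_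
    rw [one_mul]
    have hcoord : ∀ i, Tendsto (fun δ => monomialInv m (fun j => b j / ε δ j) t i) l (nhds 0) := by
      intro i
      refine Real.tendsto_exp_atBot.comp ?_
      refine (tendsto_atBot_add_const_left l
        (∑ j, B i j * (Real.log (t j) - Real.log (b j)))
        (tendsto_neg_atTop_atBot.comp (hpos i l _ hL))).congr' ?_
      filter_upwards [hε] with δ hδ
      exact (hlog b (ε δ) t hb hδ i).symm
    have hvec : Tendsto (fun δ => monomialInv m (fun j => b j / ε δ j) t) l (nhds 0) :=
      tendsto_pi_nhds.2 hcoord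
    refine ((hg.tendsto 0).comp hvec).congr' ?_
    have hlt : ∀ᶠ δ in l, ∀ i, monomialInv m (fun j => b j / ε δ j) t i < 1 :=
      eventually_all.2 fun i => (hcoord i).eventually_lt_const one_pos
    filter_upwards [hlt] with δ hδ
    rw [Set.indicator_of_mem (fun i _ => ⟨Real.exp_pos _, hδ i⟩)]
    rfl
  · push Not at hpos
    obtain ⟨i, hi⟩ := hpos
    refine ⟨0, by simp, ?_⟩
    intro χ hχ h0 h1 g hg K hK l _ ε hε hL b hb
    have hbot := (tendsto_sum_lexGrowing_or (X := ℝ) (hrow i)).resolve_left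
      (fun h => by obtain ⟨l, L, h2, h3⟩ := hi; exact h3 (h l L h2)) l _ hL
    rw [← mul_zero σ]
    refine reduce 0 χ hχ h0 h1 g hg K hK l ε hε b hb fun t => ?_
    rw [zero_mul]
    have hcoord : Tendsto (fun δ => monomialInv m (fun j => b j / ε δ j) t i) l atTop := by
      refine Real.tendsto_exp_atTop.comp ?_
      refine (tendsto_atTop_add_const_left l
        (∑ j, B i j * (Real.log (t j) - Real.log (b j)))
        (tendsto_neg_atBot_atTop.comp hbot)).congr' ?_
      filter_upwards [hε] with δ hδ
      exact (hlog b (ε δ) t hb hδ i).symm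
    refine tendsto_const_nhds.congr' ?_
    filter_upwards [hcoord.eventually_ge_atTop 1] with δ hδ
    exact (Set.indicator_of_notMem (fun h => absurd (h i trivial).2 (not_lt.2 hδ)) _).symm

lemma exists_measurableEquiv_pi_prod {ι κ ν : Type*} [Fintype ι] [Fintype κ] [Fintype ν]
    (E : κ ⊕ ι ≃ ν) :
    ∃ Φ : ((κ → ℝ) × (ι → ℝ)) ≃ᵐ (ν → ℝ), MeasurePreserving Φ volume volume ∧ Continuous Φ ∧
      (∀ q k, Φ q (E (Sum.inl k)) = q.1 k) ∧ (∀ q i, Φ q (E (Sum.inr i)) = q.2 i) := by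
  refine ⟨(MeasurableEquiv.sumPiEquivProdPi fun _ => ℝ).symm.trans
    (MeasurableEquiv.piCongrLeft (fun _ => ℝ) E),
    (volume_measurePreserving_piCongrLeft (fun _ => ℝ) E).comp
      (volume_measurePreserving_sumPiEquivProdPi_symm fun _ => ℝ), ?_, ?_, ?_⟩
  · refine continuous_pi fun v => ?_
    obtain ⟨w, rfl⟩ := E.surjective v
    simp only [MeasurableEquiv.coe_trans, Function.comp_apply, MeasurableEquiv.coe_piCongrLeft,
      Equiv.piCongrLeft_apply_apply, MeasurableEquiv.coe_sumPiEquivProdPi_symm]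
    rcases w with k | i
    · exact (continuous_apply k).comp continuous_fst
    · exact (continuous_apply i).comp continuous_snd
  · intro q k
    simp only [MeasurableEquiv.coe_trans, Function.comp_apply, MeasurableEquiv.coe_piCongrLeft,
      Equiv.piCongrLeft_apply_apply, MeasurableEquiv.coe_sumPiEquivProdPi_symm]
    rfl
  · intro q k
    simp only [MeasurableEquiv.coe_trans, Function.comp_apply, MeasurableEquiv.coe_piCongrLeft,
      Equiv.piCongrLeft_apply_apply, MeasurableEquiv.coe_sumPiEquivProdPi_symm]
    rfl

/-- Partial derivatives of a cut-off function of a monomial. -/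
lemma fderiv_cutoff_apply_single {κ : Type*} [Fintype κ] [DecidableEq κ] {χ : ℝ → ℝ}
    (hχ : Differentiable ℝ χ) (m : κ → ℕ) (ε : ℝ) {r : κ → ℝ} (hr : ∀ i, 0 < r i) (k : κ) :
    fderiv ℝ (fun s : κ → ℝ => χ ((∏ i, s i ^ m i) / ε)) r (Pi.single k 1) =
      deriv χ ((∏ i, r i ^ m i) / ε) * (m k * (∏ i, r i ^ m i) / r k / ε) := by
  have h1 : HasFDerivAt (fun s : κ → ℝ => (∏ i, s i ^ m i) / ε) _ r :=
    (hasFDerivAt_prod_pow m hr).mul_const ε⁻¹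
  have h2 := ((hχ ((∏ i, r i ^ m i) / ε)).hasDerivAt).comp_hasFDerivAt r h1
  have h3 : fderiv ℝ (fun s : κ → ℝ => χ ((∏ i, s i ^ m i) / ε)) r = _ := h2.fderiv
  rw [h3]
  simp [Pi.single_apply, div_eq_mul_inv]
  left
  ring

lemma continuous_det_fderiv_cutoff {κ ι : Type*} [Fintype κ] [DecidableEq κ] [Fintype ι]
    [DecidableEq ι] {χ : ℝ → ℝ} (hχ : ContDiff ℝ (⊤ : ℕ∞) χ) (m : ι → κ → ℕ) (ε : ι → ℝ)
    (e : ι → κ) :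
    Continuous fun r : κ → ℝ => Matrix.det fun j i : ι =>
      fderiv ℝ (fun s : κ → ℝ => χ ((∏ k, s k ^ m j k) / ε j)) r (Pi.single (e i) 1) := by
  refine Continuous.matrix_det (continuous_matrix fun j i => ?_)
  have h : ContDiff ℝ (⊤ : ℕ∞) fun s : κ → ℝ => χ ((∏ k, s k ^ m j k) / ε j) := by
    refine hχ.comp (ContDiff.div_const (contDiff_prod fun k _ => ?_) _)
    exact (contDiff_apply ℝ ℝ k).pow _
  exact (h.continuous_fderiv (by simp)).clm_apply continuous_const

/-- Passare's model computation, eq. (16)/(23) of [PCrelle]: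
I(ε) = ∫_{(0,1)^n} dχ_1^ε ∧ ⋯ ∧ dχ_p^ε · 𝒥 dr_M, where the wedge of the
differentials against dr_M is written as the determinant of the partial
derivatives in the directions e(·) complementary to M. Along any path with
ε_{j−1} ≤ C ε_j^k for all k, the limit exists and equals c·∫ 𝒥(0, r_M) dr_M with
c ∈ {1, −1, 0} depending only on the exponent matrix α and M — not on χ, 𝒥 or
the path. (Since (0,1)^n has volume 1 and the integrand of the limit value is
independent of the coordinates outside M, the n-dimensional integral below
equals the (n−p)-dimensional one.) -/
theorem stmt18 (n p : ℕ) (hp : 1 ≤ p) (hpn : p ≤ n) (α : Fin p → Fin n → ℕ)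
    (hind : LinearIndependent ℝ fun j : Fin p => fun i => (α j i : ℝ))
    (M : Finset (Fin n)) (hM : M.card = n - p)
    (e : Fin p → Fin n) (he : Function.Injective e) (heM : ∀ i, e i ∉ M) :
    ∃ c : ℝ, (c = 1 ∨ c = -1 ∨ c = 0) ∧
      ∀ χ : ℝ → ℝ, ContDiff ℝ (⊤ : ℕ∞) χ →
        (∀ᶠ t in nhds 0, χ t = 0) → (∀ᶠ t in atTop, χ t = 1) →
        (∀ t, χ t ∈ Set.Icc (0 : ℝ) 1) →
      ∀ 𝒥 : (Fin n → ℝ) → ℝ, ContDiff ℝ (⊤ : ℕ∞) 𝒥 → HasCompactSupport 𝒥 →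
      ∀ ε : ℝ → Fin p → ℝ,
        (∀ δ > (0 : ℝ), ∀ j, 0 < ε δ j) →
        (∀ j, Tendsto (fun δ => ε δ j) (nhdsWithin 0 (Set.Ioi 0)) (nhds 0)) →
        (∀ (kk : ℕ) (j : Fin p) (hj : (j : ℕ) + 1 < p), ∃ C : ℝ, ∀ δ > (0 : ℝ),
          ε δ j ≤ C * ε δ ⟨(j : ℕ) + 1, hj⟩ ^ kk) →
        Tendsto (fun δ =>
            ∫ r in Set.pi Set.univ fun _ : Fin n => Set.Ioo (0 : ℝ) 1,
              (Matrix.det fun jj ii : Fin p =>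
                fderiv ℝ (fun s : Fin n → ℝ =>
                  χ ((∏ i, s i ^ (2 * α jj i)) / ε δ jj)) r (Pi.single (e ii) 1)) * 𝒥 r)
          (nhdsWithin 0 (Set.Ioi 0))
          (nhds (c * ∫ t in Set.pi Set.univ fun _ : Fin n => Set.Ioo (0 : ℝ) 1,
            𝒥 fun i => if i ∈ M then t i else 0)) := by
  obtain ⟨c, hc3, hc⟩ := exists_tendsto_setIntegral_monomialMap fun j i => 2 * α j (e i)
  refine ⟨c, hc3, ?_⟩
  intro χ hχ h0 h1 _ 𝒥 hJ hJs ε hε hε0 hdom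
  have hEbij : Function.Bijective (Sum.elim (Subtype.val : M → Fin n) e) := by
    rw [Fintype.bijective_iff_injective_and_card]
    refine ⟨Subtype.val_injective.sumElim he fun a b h => heM b (h ▸ a.2), ?_⟩
    simp only [Fintype.card_sum, Fintype.card_coe, Fintype.card_fin, hM]
    omega
  obtain ⟨Φ, hΦ, hΦc, hΦ1, hΦ2⟩ := exists_measurableEquiv_pi_prod (Equiv.ofBijective _ hEbij)
  simp only [Equiv.ofBijective_apply, Sum.elim_inl, Sum.elim_inr] at hΦ1 hΦ2
  have hall : ∀ P : Fin n → Prop, (∀ v, P v) ↔ (∀ k : M, P k) ∧ ∀ i, P (e i) := by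
    intro P
    rw [← (Equiv.ofBijective _ hEbij).forall_congr_right, Sum.forall]
    rfl
  have hcube : Φ ⁻¹' (Set.pi Set.univ fun _ : Fin n => Set.Ioo (0 : ℝ) 1) =
      (Set.pi Set.univ fun _ : M => Set.Ioo (0 : ℝ) 1) ×ˢ
        (Set.pi Set.univ fun _ : Fin p => Set.Ioo (0 : ℝ) 1) := by
    ext q
    simp only [Set.mem_preimage, Set.mem_univ_pi, Set.mem_prod]
    rw [hall]
    simp only [hΦ1, hΦ2]
  set Qn : Set (Fin n → ℝ) := Set.pi Set.univ fun _ => Set.Ioo (0 : ℝ) 1 with hQn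
  set Qk : Set (M → ℝ) := Set.pi Set.univ fun _ => Set.Ioo (0 : ℝ) 1 with hQk
  set Qp : Set (Fin p → ℝ) := Set.pi Set.univ fun _ => Set.Ioo (0 : ℝ) 1 with hQp
  have hQkm : MeasurableSet Qk := MeasurableSet.univ_pi fun _ => measurableSet_Ioo
  have hQpm : MeasurableSet Qp := MeasurableSet.univ_pi fun _ => measurableSet_Ioo
  have hQkv : volume Qk = 1 := by simp [hQk, volume_pi, Measure.pi_pi]
  have hQpv : volume.real Qp = 1 := by simp [hQp, measureReal_def, volume_pi, Measure.pi_pi]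
  have hintOn : ∀ f : (Fin n → ℝ) → ℝ, Continuous f →
      IntegrableOn (fun q => f (Φ q)) (Qk ×ˢ Qp) (volume.prod volume) := by
    intro f hf
    rw [← hcube]
    refine (hΦ.integrableOn_comp_preimage Φ.measurableEmbedding).2 ?_
    exact (hf.continuousOn.integrableOn_compact
      (isCompact_univ_pi fun _ => isCompact_Icc)).mono_set
        (Set.pi_mono fun _ _ => Set.Ioo_subset_Icc_self)
  have hfub : ∀ f : (Fin n → ℝ) → ℝ, Continuous f →
      ∫ r in Qn, f r = ∫ y in Qk, ∫ x in Qp, f (Φ (y, x)) := by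
    intro f hf
    rw [← hΦ.setIntegral_preimage_emb Φ.measurableEmbedding f Qn, hcube]
    exact setIntegral_prod (fun q => f (Φ q)) (hintOn f hf)
  have hproj : ∀ y x, (fun i => if i ∈ M then Φ (y, x) i else 0) = Φ (y, 0) := by
    intro y x
    refine funext ((hall _).2 ⟨fun k => ?_, fun i => ?_⟩)
    · rw [if_pos k.2, hΦ1, hΦ1]
    · rw [if_neg (heM i), hΦ2]
      rfl
  have hrhs : ∫ t in Qn, 𝒥 (fun i => if i ∈ M then t i else 0) = ∫ y in Qk, 𝒥 (Φ (y, 0)) := by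
    rw [hfub (fun t => 𝒥 fun i => if i ∈ M then t i else 0)]
    · simp only [hproj, setIntegral_const, hQpv, one_smul]
    · refine hJ.continuous.comp (continuous_pi fun i => ?_)
      by_cases hi : i ∈ M
      · simpa [hi] using continuous_apply i
      · simpa [hi] using continuous_const
  obtain ⟨K, hK⟩ := hJs.exists_bound_of_continuous hJ.continuous
  obtain ⟨hint, -⟩ := integrableOn_deriv_and_integral_eq_one hχ h0 h1
  have hmem : ∀ᶠ δ in nhdsWithin (0 : ℝ) (Set.Ioi 0), 0 < δ := self_mem_nhdsWithin
  have hεev : ∀ᶠ δ in nhdsWithin (0 : ℝ) (Set.Ioi 0), ∀ j, 0 < ε δ j := hmem.mono hε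
  have hlex : LexGrowing (nhdsWithin (0 : ℝ) (Set.Ioi 0)) fun δ j => -Real.log (ε δ j) := by
    refine lexGrowing_neg_log hεev hε0 fun k j hj => ?_
    obtain ⟨C, hC⟩ := hdom k j hj
    exact ⟨C, hmem.mono hC⟩
  set b : (M → ℝ) → Fin p → ℝ := fun y j => ∏ k : M, y k ^ (2 * α j k) with hb
  have hbpos : ∀ y ∈ Qk, ∀ j, 0 < b y j := fun y hy j =>
    Finset.prod_pos fun k _ => pow_pos (hy k trivial).1 _
  have hcont : ∀ δ, Continuous fun r : Fin n → ℝ => (Matrix.det fun jj ii : Fin p =>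
      fderiv ℝ (fun s : Fin n → ℝ =>
        χ ((∏ i, s i ^ (2 * α jj i)) / ε δ jj)) r (Pi.single (e ii) 1)) * 𝒥 r := fun δ =>
    (continuous_det_fderiv_cutoff hχ (fun j i => 2 * α j i) (ε δ) e).mul hJ.continuous
  have hinner : ∀ δ, ∀ y ∈ Qk, ∫ x in Qp, (Matrix.det fun jj ii : Fin p =>
      fderiv ℝ (fun s : Fin n → ℝ => χ ((∏ i, s i ^ (2 * α jj i)) / ε δ jj)) (Φ (y, x))
        (Pi.single (e ii) 1)) * 𝒥 (Φ (y, x)) =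
      ∫ x in Qp, (∏ j, deriv χ (monomialMap (fun j i => 2 * α j (e i))
          (fun j => b y j / ε δ j) x j)) *
        (monomialJacobian (fun j i => 2 * α j (e i)) (fun j => b y j / ε δ j) x).det *
          𝒥 (Φ (y, x)) := by
    intro δ y hy
    refine setIntegral_congr_fun hQpm fun x hx => ?_
    have hr : ∀ v, 0 < Φ (y, x) v := by
      rw [hall]
      simp only [hΦ1, hΦ2]
      exact ⟨fun k => (hy k trivial).1, fun i => (hx i trivial).1⟩
    have hprod : ∀ j, ∏ v, Φ (y, x) v ^ (2 * α j v) = b y j * ∏ i, x i ^ (2 * α j (e i)) := by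
      intro j
      rw [← (Equiv.ofBijective _ hEbij).prod_comp, Fintype.prod_sum_type]
      simp only [Equiv.ofBijective_apply, Sum.elim_inl, Sum.elim_inr, hΦ1, hΦ2, hb]
    rw [← Matrix.det_mul_column]
    congr 2
    ext j i
    rw [fderiv_cutoff_apply_single (hχ.differentiable (by simp)) (fun v => 2 * α j v) (ε δ j) hr,
      hprod, hΦ2]
    simp only [Matrix.of_apply, monomialMap, monomialJacobian]
    rw [show b y j / ε δ j * ∏ i, x i ^ (2 * α j (e i)) =
      b y j * (∏ i, x i ^ (2 * α j (e i))) / ε δ j by ring]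
    ring
  rw [hrhs, ← integral_const_mul]
  simp only [hfub _ (hcont _)]
  have : IsFiniteMeasure (volume.restrict Qk) := ⟨by simp [hQkv]⟩
  refine tendsto_integral_filter_of_dominated_convergence
    (fun _ => ∫ t in Set.pi Set.univ fun _ : Fin p => Set.Ioi (0 : ℝ), ‖∏ j, deriv χ (t j)‖ * K)
    (Eventually.of_forall fun δ => ?_) ?_ (integrable_const _) ?_
  · have h := hintOn _ (hcont δ)
    rw [IntegrableOn, ← Measure.prod_restrict] at h
    exact h.integral_prod_left.aestronglyMeasurable
  · filter_upwards [hεev] with δ hδ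
    filter_upwards [ae_restrict_mem hQkm] with y hy
    rw [hinner δ y hy]
    exact norm_setIntegral_monomialMap_le _ (fun j => div_pos (hbpos y hy j) (hδ j)) hint
      (g := fun x => 𝒥 (Φ (y, x))) fun x => hK _
  · filter_upwards [ae_restrict_mem hQkm] with y hy
    simp only [hinner _ y hy]
    exact hc χ hχ h0 h1 (fun x => 𝒥 (Φ (y, x)))
      (hJ.continuous.comp (hΦc.comp (by fun_prop))) K (fun x => hK _) _ ε hεev hlex (b y)
      (hbpos y hy)
end
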